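/- arXiv:2210.00701 — 6 statements merged into one kernel-verified Lean document; each statement's English description precedes it below -/
import Mathlib

section
/- Let Φ ⊂ ℝ^d be a finite set of vectors and Π a finite set of policies, each policy π ∈ Π being a probability mass function on Φ. Define Φ̂ = {a ∈ Φ : π(a) > 0 for some π ∈ Π}. If span(Φ̂) = ℝ^d, then there exists a probability mass function μ* on Π such that the matrix V(μ*) = Σ_{π∈Π} μ*(π) Σ_{a∈Φ} π(a) a aᵀ is invertible and max_{π∈Π} Σ_{a∈Φ} π(a) aᵀ V(μ*)⁻¹ a ≤ d. -/
open Matrix Finset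

open Filter Topology in
/-- First-order optimality for the determinant: if `det` does not exceed `det V > 0` on the
segment from `V` to `A`, then `tr (V⁻¹ A)` is at most the size of the matrices. -/
lemma Matrix.trace_inv_mul_le_card_of_det_le {n : Type*} [Fintype n] [DecidableEq n]
    {V A : Matrix n n ℝ} (hV : 0 < V.det)
    (hmax : ∀ r : ℝ, 0 < r → r < 1 → (V + r • (A - V)).det ≤ V.det) :
    (V⁻¹ * A).trace ≤ Fintype.card n := by
  have hunit : IsUnit V.det := hV.ne'.isUnit
  set M : Matrix n n ℝ := V⁻¹ * A - 1 with hM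
  have hVM : ∀ r : ℝ, V + r • (A - V) = V * (1 + r • M) := fun r ↦ by
    rw [hM, mul_add, mul_one, mul_smul_comm, mul_sub, mul_one, mul_nonsing_inv_cancel_left _ _ hunit]
  set q := (1 + (Polynomial.X : Polynomial ℝ) • M.map Polynomial.C).det.divX.divX with hq
  have hbound : ∀ᶠ r in 𝓝[>] (0 : ℝ), M.trace + q.eval r * r ≤ 0 := by
    filter_upwards [Ioo_mem_nhdsGT (zero_lt_one (α := ℝ))] with r hr
    have h := hmax r hr.1 hr.2
    rw [hVM, det_mul, det_one_add_smul, ← hq] at h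
    have h1 : 1 + M.trace * r + q.eval r * r ^ 2 ≤ 1 :=
      le_of_mul_le_mul_left (by simpa using h) hV
    exact nonpos_of_mul_nonpos_left (by linarith : (M.trace + q.eval r * r) * r ≤ 0) hr.1
  have hlim : Tendsto (fun r : ℝ ↦ M.trace + q.eval r * r) (𝓝[>] 0) (𝓝 M.trace) := by
    have hc : Continuous fun r : ℝ ↦ M.trace + q.eval r * r := by fun_prop
    simpa using (hc.tendsto 0).mono_left nhdsWithin_le_nhds
  have htr : M.trace ≤ 0 := le_of_tendsto hlim hbound
  rw [hM, trace_sub, trace_one] at htr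
  linarith

/-- A D-optimal design: if some convex combination of the matrices `A i` has positive determinant,
then some convex combination `V` is invertible with `tr (V⁻¹ A i)` at most the size of the matrices
for every `i`. -/
lemma Matrix.exists_stdSimplex_trace_inv_mul_le_card {ι n : Type*} [Fintype ι] [Fintype n]
    [DecidableEq n] (A : ι → Matrix n n ℝ)
    (hA : ∃ w ∈ stdSimplex ℝ ι, 0 < (∑ i, w i • A i).det) :
    ∃ w ∈ stdSimplex ℝ ι, IsUnit (∑ i, w i • A i).det ∧
      ∀ j, ((∑ i, w i • A i)⁻¹ * A j).trace ≤ Fintype.card n := by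
  classical
  obtain ⟨w₀, hw₀, hdet₀⟩ := hA
  have hcont : Continuous fun w : ι → ℝ ↦ (∑ i, w i • A i).det := by fun_prop
  obtain ⟨w, hw, hmax⟩ :=
    (isCompact_stdSimplex ℝ ι).exists_isMaxOn ⟨w₀, hw₀⟩ hcont.continuousOn
  have hpos : 0 < (∑ i, w i • A i).det := hdet₀.trans_le (hmax hw₀)
  refine ⟨w, hw, hpos.ne'.isUnit, fun j ↦ trace_inv_mul_le_card_of_det_le hpos fun r hr0 hr1 ↦ ?_⟩
  have hmem : w + r • (Pi.single j 1 - w) ∈ stdSimplex ℝ ι :=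
    (convex_stdSimplex ℝ ι).add_smul_sub_mem hw (single_mem_stdSimplex ℝ j) ⟨hr0.le, hr1.le⟩
  have hcomb : ∑ i, (w + r • (Pi.single j 1 - w) : ι → ℝ) i • A i
      = ∑ i, w i • A i + r • (A j - ∑ i, w i • A i) := by
    simp [add_smul, sub_smul, mul_smul, sum_add_distrib, ← smul_sum, Pi.single_apply]
  exact hcomb ▸ hmax hmem

/-- A nonnegative combination of the matrices `a aᵀ` is positive definite when the vectors of
positive weight span. -/
lemma Matrix.posDef_sum_smul_vecMulVec {n : Type*} [Fintype n]
    (Φ : Finset (n → ℝ)) (c : (n → ℝ) → ℝ) (hc : ∀ a ∈ Φ, 0 ≤ c a)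
    (hspan : Submodule.span ℝ {a | a ∈ Φ ∧ 0 < c a} = ⊤) :
    (∑ a ∈ Φ, c a • vecMulVec a a).PosDef := by
  have hform : ∀ x : n → ℝ,
      x ⬝ᵥ ((∑ a ∈ Φ, c a • vecMulVec a a) *ᵥ x) = ∑ a ∈ Φ, c a * (a ⬝ᵥ x) ^ 2 := fun x ↦ by
    rw [sum_mulVec, dotProduct_sum]
    refine sum_congr rfl fun a _ ↦ ?_
    simp [smul_mulVec, vecMulVec_mulVec, dotProduct_comm x a, sq]
  have hnonneg : ∀ x : n → ℝ, ∀ a ∈ Φ, 0 ≤ c a * (a ⬝ᵥ x) ^ 2 := fun x a ha ↦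
    mul_nonneg (hc a ha) (sq_nonneg _)
  refine .of_dotProduct_mulVec_pos ?_ fun {x} hx ↦ ?_
  · simp [IsHermitian, transpose_sum, transpose_smul, transpose_vecMulVec]
  rw [star_trivial, hform]
  refine (sum_nonneg (hnonneg x)).lt_of_ne fun h0 ↦ hx ?_
  have hzero := (sum_eq_zero_iff_of_nonneg (hnonneg x)).1 h0.symm
  have hx_mem : x ∈ Submodule.span ℝ {a | a ∈ Φ ∧ 0 < c a} := hspan ▸ Submodule.mem_top
  have hker : ∀ y ∈ Submodule.span ℝ {a | a ∈ Φ ∧ 0 < c a}, y ⬝ᵥ x = 0 := fun y hy ↦ by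
    induction hy using Submodule.span_induction with
    | mem a ha => simpa [ha.2.ne'] using hzero a ha.1
    | zero => simp
    | add y z _ _ hy hz => rw [add_dotProduct, hy, hz, add_zero]
    | smul t y _ hy => rw [smul_dotProduct, hy, smul_zero]
  exact dotProduct_self_eq_zero.1 (hker x hx_mem)

/-- Generalized G-optimal design theorem (Qiao–Wang, Theorem D.1): if the supports of the
policies in `P` span `ℝ^d`, then there is a distribution `μ` over `P` such that the design
matrix `V(μ) = ∑_π μ(π) ∑_a π(a) a aᵀ` is invertible and
`∑_a π(a) aᵀ V(μ)⁻¹ a ≤ d` for every `π ∈ P`. -/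
theorem generalized_G_optimal_design {d : ℕ} (hd : 1 ≤ d)
    (Φ : Finset (Fin d → ℝ)) (P : Finset ((Fin d → ℝ) → ℝ))
    (hpmf : ∀ π ∈ P, (∀ a ∈ Φ, 0 ≤ π a) ∧ ∑ a ∈ Φ, π a = 1)
    (hspan : Submodule.span ℝ {a : Fin d → ℝ | a ∈ Φ ∧ ∃ π ∈ P, 0 < π a} = ⊤) :
    ∃ μ : ((Fin d → ℝ) → ℝ) → ℝ,
      (∀ π ∈ P, 0 ≤ μ π) ∧ (∑ π ∈ P, μ π = 1) ∧
      IsUnit (∑ π ∈ P, μ π • ∑ a ∈ Φ, π a • vecMulVec a a).det ∧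
      ∀ π ∈ P,
        ∑ a ∈ Φ, π a *
          (a ⬝ᵥ ((∑ π' ∈ P, μ π' • ∑ a' ∈ Φ, π' a' • vecMulVec a' a')⁻¹ *ᵥ a)) ≤ d := by
  classical
  have : Nonempty (Fin d) := ⟨⟨0, hd⟩⟩
  have hP : P.Nonempty := by
    rw [nonempty_iff_ne_empty]
    rintro rfl
    simp at hspan
  have hcard : (0 : ℝ) < #P := by exact_mod_cast hP.card_pos
  have hunif : (fun _ : P ↦ (#P : ℝ)⁻¹) ∈ stdSimplex ℝ P :=
    ⟨fun _ ↦ by positivity, by simp [hcard.ne']⟩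
  have hdet : 0 < (∑ π : P, (#P : ℝ)⁻¹ • ∑ a ∈ Φ, π.1 a • vecMulVec a a).det := by
    have hsum : ∑ π : P, (#P : ℝ)⁻¹ • ∑ a ∈ Φ, π.1 a • vecMulVec a a
        = (#P : ℝ)⁻¹ • ∑ a ∈ Φ, (∑ π ∈ P, π a) • vecMulVec a a := by
      rw [← smul_sum, sum_coe_sort P (fun π ↦ ∑ a ∈ Φ, π a • vecMulVec a a), sum_comm]
      simp_rw [sum_smul]
    rw [hsum]
    refine ((posDef_sum_smul_vecMulVec Φ _
      (fun a ha ↦ sum_nonneg fun π hπ ↦ (hpmf π hπ).1 a ha) ?_).smul (by positivity)).det_pos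
    refine top_unique (hspan.symm.trans_le (Submodule.span_mono ?_))
    rintro a ⟨ha, π, hπ, hpos⟩
    exact ⟨ha, sum_pos' (fun π' hπ' ↦ (hpmf π' hπ').1 a ha) ⟨π, hπ, hpos⟩⟩
  obtain ⟨w, hw, hu, htr⟩ := exists_stdSimplex_trace_inv_mul_le_card
    (fun π : P ↦ ∑ a ∈ Φ, π.1 a • vecMulVec a a) ⟨_, hunif, hdet⟩
  let μ : ((Fin d → ℝ) → ℝ) → ℝ := fun π ↦ if h : π ∈ P then w ⟨π, h⟩ else 0
  have hμ : ∀ π : P, μ π = w π := fun π ↦ by simp [μ]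
  have hV : ∑ π ∈ P, μ π • ∑ a ∈ Φ, π a • vecMulVec a a
      = ∑ π : P, w π • ∑ a ∈ Φ, π.1 a • vecMulVec a a := by
    simp_rw [← hμ]
    exact (sum_coe_sort P fun π ↦ μ π • ∑ a ∈ Φ, π a • vecMulVec a a).symm
  refine ⟨μ, fun π hπ ↦ hμ ⟨π, hπ⟩ ▸ hw.1 _, ?_, hV ▸ hu, fun π hπ ↦ ?_⟩
  · rw [← sum_coe_sort P μ]
    simpa only [hμ] using hw.2
  · rw [hV]
    have h := htr ⟨π, hπ⟩
    rw [Fintype.card_fin] at h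
    refine le_of_eq_of_le ?_ h
    rw [mul_sum, trace_sum]
    refine sum_congr rfl fun a _ ↦ ?_
    rw [mul_smul_comm, trace_smul, mul_vecMulVec, trace_vecMulVec, dotProduct_comm, smul_eq_mul]
end

section
/- Let Φ ⊂ ℝ^d be a finite set of vectors and Π a finite set of policies, each policy π ∈ Π being a probability mass function on Φ, and suppose span(Φ̂) = ℝ^d where Φ̂ = {a ∈ Φ : π(a) > 0 for some π ∈ Π}. If μ* is a probability mass function on Π that maximizes det V(μ) over all probability mass functions μ on Π, then V(μ*) is positive definite and for every π ∈ Π one has Σ_{a∈Φ} π(a) aᵀ V(μ*)⁻¹ a ≤ d. -/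
open Matrix Finset

/-- If the determinant does not increase along the segment from a positive definite `V` to `G`,
then `trace (V⁻¹ * G)` is at most the dimension. -/
lemma trace_inv_mul_le_card_of_det_segment_le {n : Type*} [Fintype n] [DecidableEq n]
    {V G : Matrix n n ℝ} (hV : V.PosDef)
    (h : ∀ t : ℝ, 0 < t → t ≤ 1 → (V + t • (G - V)).det ≤ V.det) :
    (V⁻¹ * G).trace ≤ Fintype.card n := by
  have hdet : 0 < V.det := hV.det_pos
  have hunit : IsUnit V.det := hdet.ne'.isUnit
  set M : Matrix n n ℝ := V⁻¹ * (G - V) with hM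
  have hM1 : M = V⁻¹ * G - 1 := by rw [hM, mul_sub, nonsing_inv_mul _ hunit]
  set p := (det (1 + (Polynomial.X : Polynomial ℝ) • M.map Polynomial.C)).divX.divX with hp
  have hle : ∀ t : ℝ, 0 < t → t ≤ 1 → M.trace + p.eval t * t ≤ 0 := by
    intro t ht0 ht1
    have hfac : V + t • (G - V) = V * (1 + t • M) := by
      rw [mul_add, mul_one, mul_smul_comm, hM, mul_nonsing_inv_cancel_left _ _ hunit]
    have h1 := h t ht0 ht1
    rw [hfac, det_mul, det_one_add_smul, ← hp] at h1
    have h2 : V.det * (t * (M.trace + p.eval t * t)) ≤ 0 := by nlinarith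
    have h3 := nonpos_of_mul_nonpos_right h2 hdet
    exact nonpos_of_mul_nonpos_right h3 ht0
  have hcont : Continuous fun t : ℝ => M.trace + p.eval t * t := by fun_prop
  have htrace : M.trace ≤ 0 := by
    have hlim : Filter.Tendsto (fun t : ℝ => M.trace + p.eval t * t)
        (nhdsWithin 0 (Set.Ioi 0)) (nhds M.trace) := by
      simpa using (hcont.tendsto 0).mono_left nhdsWithin_le_nhds
    refine le_of_tendsto hlim ?_
    filter_upwards [Ioc_mem_nhdsGT (zero_lt_one' ℝ)] with t ht using hle t ht.1 ht.2
  rw [hM1, trace_sub, trace_one] at htrace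
  linarith

/-- The quadratic form of a weighted sum of rank-one matrices `a aᵀ`. -/
lemma dotProduct_sum_smul_vecMulVec_mulVec {n : Type*} [Fintype n] (s : Finset (n → ℝ))
    (w : (n → ℝ) → ℝ) (x : n → ℝ) :
    x ⬝ᵥ ((∑ a ∈ s, w a • vecMulVec a a) *ᵥ x) = ∑ a ∈ s, w a * (a ⬝ᵥ x) ^ 2 := by
  rw [sum_mulVec, dotProduct_sum]
  refine sum_congr rfl fun a _ => ?_
  simp only [smul_mulVec, vecMulVec_mulVec, dotProduct_smul, op_smul_eq_smul, smul_eq_mul,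
    dotProduct_comm x a]
  ring

lemma posSemidef_sum_smul_vecMulVec {n : Type*} [Fintype n] {s : Finset (n → ℝ)}
    {w : (n → ℝ) → ℝ} (hw : ∀ a ∈ s, 0 ≤ w a) :
    (∑ a ∈ s, w a • vecMulVec a a).PosSemidef :=
  posSemidef_sum s fun a ha => (posSemidef_vecMulVec_self_star a).smul (hw a ha)

lemma trace_mul_sum_smul_vecMulVec {n : Type*} [Fintype n] (A : Matrix n n ℝ)
    (s : Finset (n → ℝ)) (w : (n → ℝ) → ℝ) :
    (A * ∑ a ∈ s, w a • vecMulVec a a).trace = ∑ a ∈ s, w a * (a ⬝ᵥ (A *ᵥ a)) := by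
  simp only [Matrix.mul_sum, trace_sum, mul_smul_comm, trace_smul, mul_vecMulVec,
    trace_vecMulVec, smul_eq_mul, dotProduct_comm]

/-- A design with full support has a positive definite design matrix as soon as the supports of
the policies span the space. -/
lemma posDef_sum_smul_sum_smul_vecMulVec {n : Type*} [Fintype n]
    {Φ : Finset (n → ℝ)} {P : Finset ((n → ℝ) → ℝ)} (hP : ∀ π ∈ P, ∀ a ∈ Φ, 0 ≤ π a)
    (hspan : Submodule.span ℝ {a : n → ℝ | a ∈ Φ ∧ ∃ π ∈ P, 0 < π a} = ⊤)
    {μ : ((n → ℝ) → ℝ) → ℝ} (hμ : ∀ π ∈ P, 0 < μ π) :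
    (∑ π ∈ P, μ π • ∑ a ∈ Φ, π a • vecMulVec a a).PosDef := by
  have hpsd : (∑ π ∈ P, μ π • ∑ a ∈ Φ, π a • vecMulVec a a).PosSemidef :=
    posSemidef_sum P fun π hπ => (posSemidef_sum_smul_vecMulVec (hP π hπ)).smul (hμ π hπ).le
  refine .of_dotProduct_mulVec_pos hpsd.1 fun x hx => ?_
  refine (hpsd.dotProduct_mulVec_nonneg x).lt_of_ne' fun h0 => hx ?_
  rw [star_trivial, sum_mulVec, dotProduct_sum] at h0
  simp only [smul_mulVec, dotProduct_smul, dotProduct_sum_smul_vecMulVec_mulVec,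
    smul_eq_mul] at h0
  have hterm : ∀ π ∈ P, ∀ a ∈ Φ, 0 ≤ π a * (a ⬝ᵥ x) ^ 2 := fun π hπ a ha =>
    mul_nonneg (hP π hπ a ha) (sq_nonneg _)
  rw [sum_eq_zero_iff_of_nonneg fun π hπ => mul_nonneg (hμ π hπ).le (sum_nonneg (hterm π hπ))]
    at h0
  have horth : ∀ a ∈ Submodule.span ℝ {a : n → ℝ | a ∈ Φ ∧ ∃ π ∈ P, 0 < π a}, a ⬝ᵥ x = 0 := by
    intro a ha
    induction ha using Submodule.span_induction with
    | mem a ha =>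
      obtain ⟨haΦ, π, hπ, hpos⟩ := ha
      have h1 := (mul_eq_zero.mp (h0 π hπ)).resolve_left (hμ π hπ).ne'
      have h2 := (sum_eq_zero_iff_of_nonneg (hterm π hπ)).mp h1 a haΦ
      exact pow_eq_zero_iff two_ne_zero |>.mp ((mul_eq_zero.mp h2).resolve_left hpos.ne')
    | zero => exact zero_dotProduct x
    | add a b _ _ ha hb => rw [add_dotProduct, ha, hb, add_zero]
    | smul c a _ ha => rw [smul_dotProduct, ha, smul_zero]
  exact dotProduct_self_eq_zero.mp (horth x (hspan ▸ Submodule.mem_top))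

/-- D-optimal design is a generalized G-optimal design (first-order optimality step of
Qiao–Wang, Theorem D.1): if the supports of the policies in `P` span `ℝ^d` and `μstar`
maximizes `det V(μ)` over all probability mass functions `μ` on `P`, then `V(μstar)` is
positive definite and `∑_a π(a) aᵀ V(μstar)⁻¹ a ≤ d` for every `π ∈ P`. -/
theorem D_optimal_is_G_optimal {d : ℕ} (hd : 1 ≤ d)
    (Φ : Finset (Fin d → ℝ)) (P : Finset ((Fin d → ℝ) → ℝ))
    (hpmf : ∀ π ∈ P, (∀ a ∈ Φ, 0 ≤ π a) ∧ ∑ a ∈ Φ, π a = 1)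
    (hspan : Submodule.span ℝ {a : Fin d → ℝ | a ∈ Φ ∧ ∃ π ∈ P, 0 < π a} = ⊤)
    (μstar : ((Fin d → ℝ) → ℝ) → ℝ)
    (hμstar_nonneg : ∀ π ∈ P, 0 ≤ μstar π) (hμstar_sum : ∑ π ∈ P, μstar π = 1)
    (hmax : ∀ μ : ((Fin d → ℝ) → ℝ) → ℝ, (∀ π ∈ P, 0 ≤ μ π) → (∑ π ∈ P, μ π = 1) →
      (∑ π ∈ P, μ π • ∑ a ∈ Φ, π a • vecMulVec a a).det ≤
        (∑ π ∈ P, μstar π • ∑ a ∈ Φ, π a • vecMulVec a a).det) :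
    (∑ π ∈ P, μstar π • ∑ a ∈ Φ, π a • vecMulVec a a).PosDef ∧
    ∀ π ∈ P,
      ∑ a ∈ Φ, π a *
        (a ⬝ᵥ ((∑ π' ∈ P, μstar π' • ∑ a' ∈ Φ, π' a' • vecMulVec a' a')⁻¹ *ᵥ a)) ≤ d := by
  classical
  set V : Matrix (Fin d) (Fin d) ℝ :=
    ∑ π ∈ P, μstar π • ∑ a ∈ Φ, π a • vecMulVec a a with hV
  have hP : ∀ π ∈ P, ∀ a ∈ Φ, 0 ≤ π a := fun π hπ => (hpmf π hπ).1
  have hPne : P.Nonempty := by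
    rw [nonempty_iff_ne_empty]
    rintro rfl
    simp at hμstar_sum
  have hcard : (0 : ℝ) < #P := by exact_mod_cast hPne.card_pos
  have hpsd : V.PosSemidef := posSemidef_sum P fun π hπ =>
    (posSemidef_sum_smul_vecMulVec (hP π hπ)).smul (hμstar_nonneg π hπ)
  have hpos : V.PosDef := by
    have hunif := posDef_sum_smul_sum_smul_vecMulVec hP hspan (μ := fun _ => (#P : ℝ)⁻¹)
      fun _ _ => inv_pos.mpr hcard
    have hle := hmax (fun _ => (#P : ℝ)⁻¹) (fun _ _ => (inv_pos.mpr hcard).le)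
      (by simp [hcard.ne'])
    exact hpsd.posDef_iff_det_ne_zero.mpr (hunif.det_pos.trans_le hle).ne'
  refine ⟨hpos, fun π hπ => ?_⟩
  rw [← trace_mul_sum_smul_vecMulVec]
  refine (trace_inv_mul_le_card_of_det_segment_le hpos fun t ht0 ht1 => ?_).trans_eq (by simp)
  have hle := hmax (fun ρ => (1 - t) * μstar ρ + if ρ = π then t else 0)
    (fun ρ hρ => add_nonneg (mul_nonneg (sub_nonneg.mpr ht1) (hμstar_nonneg ρ hρ))
      (by split_ifs <;> linarith))
    (by rw [sum_add_distrib, ← mul_sum, hμstar_sum, sum_ite_eq' P π, if_pos hπ]; ring)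
  convert hle using 2
  simp only [add_smul, sum_add_distrib, mul_smul, ite_smul, zero_smul, sum_ite_eq', if_pos hπ]
  rw [← smul_sum, ← hV, smul_sub, sub_smul, one_smul]
  abel
end

section
/- Let X_1, ..., X_T be d×d real positive semidefinite matrices with Tr(X_t) ≤ 1 for every t ∈ {1,...,T}. Define M_0 = I_d and M_t = M_{t-1} + X_t for t ≥ 1. Then Σ_{t=1}^T Tr(X_t M_{t-1}^{-1}) ≤ 2 d log(1 + T/d). -/
open Matrix Finset

namespace Matrix

variable {n : Type*} [Fintype n]

open scoped MatrixOrder in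
/-- A positive semidefinite matrix is of the form `Bᴴ * B`. -/
lemma PosSemidef.exists_eq_conjTranspose_mul_self {A : Matrix n n ℝ} (hA : A.PosSemidef) :
    ∃ B : Matrix n n ℝ, A = Bᴴ * B := by
  classical
  exact CStarAlgebra.nonneg_iff_eq_star_mul_self.mp hA.nonneg

lemma PosSemidef.trace_mul_nonneg {A B : Matrix n n ℝ} (hA : A.PosSemidef) (hB : B.PosSemidef) :
    0 ≤ (A * B).trace := by
  obtain ⟨C, rfl⟩ := hA.exists_eq_conjTranspose_mul_self
  rw [Matrix.mul_assoc, trace_mul_comm]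
  exact (hB.mul_mul_conjTranspose_same C).trace_nonneg

variable [DecidableEq n]

lemma IsHermitian.det_one_add {A : Matrix n n ℝ} (hA : A.IsHermitian) :
    (1 + A).det = ∏ i, (1 + hA.eigenvalues i) := by
  conv_lhs =>
    rw [hA.spectral_theorem, ← map_one (Unitary.conjStarAlgAut ℝ _ hA.eigenvectorUnitary),
      ← map_add, Unitary.conjStarAlgAut_apply, det_mul_comm, ← Matrix.mul_assoc]
  rw [Unitary.coe_star_mul_self, Matrix.one_mul, ← diagonal_one, diagonal_add, det_diagonal]
  simp

lemma PosSemidef.one_add_trace_le_det_one_add {A : Matrix n n ℝ} (hA : A.PosSemidef) :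
    1 + A.trace ≤ (1 + A).det := by
  rw [hA.isHermitian.det_one_add, hA.isHermitian.trace_eq_sum_eigenvalues]
  induction (Finset.univ : Finset n) using Finset.induction_on with
  | empty => simp
  | insert i s hi ih =>
    rw [Finset.sum_insert hi, Finset.prod_insert hi]
    have hi₀ := hA.eigenvalues_nonneg i
    have hs₀ := Finset.sum_nonneg fun j (_ : j ∈ s) ↦ hA.eigenvalues_nonneg j
    simp only [RCLike.ofReal_real_eq_id, id_eq] at ih ⊢
    nlinarith [mul_nonneg hi₀ hs₀, mul_le_mul_of_nonneg_left ih hi₀]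

/-- The tangent-line bound for the concave function `log ∘ det` at `c • 1`. -/
lemma PosDef.log_det_le {A : Matrix n n ℝ} (hA : A.PosDef) {c : ℝ} (hc : 0 < c) :
    Real.log A.det ≤ A.trace / c - Fintype.card n + Fintype.card n * Real.log c := by
  have hpos := hA.eigenvalues_pos
  rw [hA.isHermitian.det_eq_prod_eigenvalues, hA.isHermitian.trace_eq_sum_eigenvalues]
  simp only [RCLike.ofReal_real_eq_id, id_eq]
  rw [Real.log_prod fun i _ ↦ (hpos i).ne']
  calc ∑ i, Real.log (hA.isHermitian.eigenvalues i)
      ≤ ∑ i, (hA.isHermitian.eigenvalues i / c - 1 + Real.log c) :=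
        Finset.sum_le_sum fun i _ ↦ by
          have h := Real.log_le_sub_one_of_pos (div_pos (hpos i) hc)
          rw [Real.log_div (hpos i).ne' hc.ne'] at h
          linarith
    _ = _ := by simp [Finset.sum_add_distrib, Finset.sum_div]

lemma PosSemidef.one_sub_inv_one_add {P : Matrix n n ℝ} (hP : P.PosSemidef) :
    (1 - (1 + P)⁻¹).PosSemidef := by
  have hM : (1 + P).PosDef := PosDef.one.add_posSemidef hP
  have hdet : IsUnit (1 + P).det := hM.det_pos.ne'.isUnit
  have h := (hP.add (hP.pow 2)).mul_mul_conjTranspose_same (1 + P)⁻¹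
  rw [hM.inv.isHermitian.eq, show P + P ^ 2 = (1 + P) * (1 + P) - (1 + P) by noncomm_ring,
    Matrix.mul_sub, Matrix.sub_mul, nonsing_inv_mul_cancel_left _ _ hdet,
    nonsing_inv_mul _ hdet, Matrix.one_mul, mul_nonsing_inv _ hdet] at h
  exact h

lemma PosSemidef.trace_mul_inv_one_add_le {P X : Matrix n n ℝ} (hP : P.PosSemidef)
    (hX : X.PosSemidef) : (X * (1 + P)⁻¹).trace ≤ X.trace := by
  have h := hX.trace_mul_nonneg hP.one_sub_inv_one_add
  rw [Matrix.mul_sub, trace_sub, Matrix.mul_one] at h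
  linarith

lemma PosDef.det_mul_one_add_trace_le {M X : Matrix n n ℝ} (hM : M.PosDef) (hX : X.PosSemidef) :
    M.det * (1 + (X * M⁻¹).trace) ≤ (M + X).det := by
  obtain ⟨B, hB⟩ := hM.inv.posSemidef.exists_eq_conjTranspose_mul_self
  have hMX : M + X = M * (1 + M⁻¹ * X) := by
    rw [Matrix.mul_add, Matrix.mul_one, mul_nonsing_inv_cancel_left _ _ hM.det_pos.ne'.isUnit]
  have htr : (X * M⁻¹).trace = (B * X * Bᴴ).trace := by
    rw [hB, ← Matrix.mul_assoc, trace_mul_comm, Matrix.mul_assoc]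
  have hdet : (1 + M⁻¹ * X).det = (1 + B * X * Bᴴ).det := by
    rw [hB, Matrix.mul_assoc, det_one_add_mul_comm]
  rw [hMX, det_mul, htr, hdet]
  exact mul_le_mul_of_nonneg_left
    (hX.mul_mul_conjTranspose_same B).one_add_trace_le_det_one_add hM.det_pos.le

end Matrix

lemma Real.le_two_mul_log_one_add {y : ℝ} (hy₀ : 0 ≤ y) (hy₂ : y ≤ 2) :
    y ≤ 2 * Real.log (1 + y) := by
  have h := Real.le_log_one_add_of_nonneg hy₀
  have h' : y / 2 ≤ 2 * y / (y + 2) := by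
    rw [div_le_div_iff₀ two_pos (by linarith)]
    nlinarith
  linarith

/-- One step of the potential argument, with potential `2 * log (det M)`. -/
lemma Matrix.PosSemidef.trace_mul_inv_add_log_det_le {n : Type*} [Fintype n] [DecidableEq n]
    {P X : Matrix n n ℝ} (hP : P.PosSemidef) (hX : X.PosSemidef) (htr : X.trace ≤ 2) :
    (X * (1 + P)⁻¹).trace + 2 * Real.log (1 + P).det ≤ 2 * Real.log (1 + P + X).det := by
  have hM : (1 + P).PosDef := PosDef.one.add_posSemidef hP
  have hy₀ := hX.trace_mul_nonneg hM.inv.posSemidef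
  have hy₂ := (hP.trace_mul_inv_one_add_le hX).trans htr
  have hlog := Real.log_le_log (mul_pos hM.det_pos (by linarith)) (hM.det_mul_one_add_trace_le hX)
  rw [Real.log_mul hM.det_pos.ne' (by linarith)] at hlog
  linarith [Real.le_two_mul_log_one_add hy₀ hy₂]

/-- Elliptical potential lemma (Lemma C.4 of Qiao–Wang, after Agarwal et al.):
for positive semidefinite matrices `X_1, ..., X_T` with trace at most `1` and
`M_t = I + X_1 + ⋯ + X_t`, we have `∑_{t=1}^T Tr(X_t M_{t-1}⁻¹) ≤ 2 d log(1 + T/d)`. -/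
theorem elliptical_potential {d T : ℕ} (hd : 0 < d) (hT : 0 < T)
    (X : ℕ → Matrix (Fin d) (Fin d) ℝ)
    (hXpsd : ∀ t ∈ Finset.Icc 1 T, (X t).PosSemidef)
    (hXtr : ∀ t ∈ Finset.Icc 1 T, (X t).trace ≤ 1)
    (M : ℕ → Matrix (Fin d) (Fin d) ℝ)
    (hM0 : M 0 = 1)
    (hMt : ∀ t ∈ Finset.Icc 1 T, M t = M (t - 1) + X t) :
    ∑ t ∈ Finset.Icc 1 T, (X t * (M (t - 1))⁻¹).trace ≤
      2 * d * Real.log (1 + (T : ℝ) / d) := by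
  have key : ∀ t ≤ T, (M t - 1).PosSemidef ∧ (M t).trace ≤ d + t ∧
      ∑ s ∈ Finset.Icc 1 t, (X s * (M (s - 1))⁻¹).trace ≤ 2 * Real.log (M t).det := by
    intro t
    induction t with
    | zero => simp [hM0, PosSemidef.zero]
    | succ t ih =>
      intro ht
      obtain ⟨hP, htr, hsum⟩ := ih (by omega)
      have hmem : t + 1 ∈ Finset.Icc 1 T := Finset.mem_Icc.mpr ⟨by omega, ht⟩
      have hM := hMt _ hmem
      have hX := hXpsd _ hmem
      have hX₁ := hXtr _ hmem
      rw [Nat.add_sub_cancel] at hM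
      refine ⟨?_, ?_, ?_⟩
      · rw [hM, add_sub_right_comm]
        exact hP.add hX
      · rw [hM, trace_add]
        push_cast
        linarith
      · have h := hP.trace_mul_inv_add_log_det_le hX (by linarith)
        rw [add_sub_cancel, ← hM] at h
        rw [Finset.sum_Icc_succ_top (by omega), Nat.add_sub_cancel]
        linarith
  obtain ⟨hP, htr, hsum⟩ := key T le_rfl
  have hMT : (M T).PosDef := by simpa using PosDef.one.add_posSemidef hP
  have hd' : (0 : ℝ) < d := Nat.cast_pos.mpr hd
  have hc : 0 < 1 + (T : ℝ) / d := by positivity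
  have hlog := hMT.log_det_le hc
  have hdiv : (M T).trace / (1 + (T : ℝ) / d) ≤ d := by
    rw [div_le_iff₀ hc, mul_add, mul_one, mul_div_cancel₀ _ hd'.ne']
    exact htr
  rw [Fintype.card_fin] at hlog
  linarith
end

section
/- Let φ_1, ..., φ_N ∈ ℝ^d and let Λ = I_d + Σ_{n=1}^N φ_n φ_nᵀ. Then Λ is positive definite and Σ_{n=1}^N φ_nᵀ Λ⁻¹ φ_n ≤ d. -/
open Matrix Finset

/-- The quadratic forms `φ_nᵀ A φ_n` sum to the trace of `A * ∑ n, φ_n φ_nᵀ`. -/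
theorem sum_dotProduct_mulVec_eq_trace {ι m R : Type*} [Fintype ι] [Fintype m] [CommSemiring R]
    (A : Matrix m m R) (φ : ι → m → R) :
    ∑ n, φ n ⬝ᵥ (A *ᵥ φ n) = (A * ∑ n, vecMulVec (φ n) (φ n)).trace := by
  simp only [Matrix.mul_sum, trace_sum, mul_vecMulVec, trace_vecMulVec, dotProduct_comm]

/-- For a real positive semidefinite `S`, the matrix `(1 + S)⁻¹ * S` has trace at most the
dimension. -/
theorem Matrix.PosSemidef.trace_inv_one_add_mul_le {m : Type*} [Fintype m] [DecidableEq m]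
    {S : Matrix m m ℝ} (hS : S.PosSemidef) :
    ((1 + S)⁻¹ * S).trace ≤ Fintype.card m := by
  have hpos : (1 + S).PosDef := PosDef.one.add_posSemidef hS
  have hdet : IsUnit (1 + S).det := (isUnit_iff_isUnit_det _).mp hpos.isUnit
  have hmul : (1 + S)⁻¹ * S = 1 - (1 + S)⁻¹ := by
    rw [eq_sub_iff_add_eq, ← mul_add_one, add_comm S, nonsing_inv_mul _ hdet]
  rw [hmul, trace_sub, trace_one]
  exact sub_le_self _ hpos.inv.posSemidef.trace_nonneg

/-- Key linear-algebraic inequality (used in Lemma D.3 of Qiao–Wang, after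
Lemma D.1 of Jin et al.): for `Λ = I + ∑_n φ_n φ_nᵀ`, the matrix `Λ` is positive
definite and `∑_n φ_nᵀ Λ⁻¹ φ_n ≤ d`. -/
theorem sum_quadform_inv_le_dim {d N : ℕ} (hd : 0 < d) (hN : 0 < N)
    (φ : Fin N → Fin d → ℝ) :
    (1 + ∑ n, vecMulVec (φ n) (φ n)).PosDef ∧
    ∑ n, φ n ⬝ᵥ ((1 + ∑ n', vecMulVec (φ n') (φ n'))⁻¹ *ᵥ φ n) ≤ d := by
  have hS : (∑ n, vecMulVec (φ n) (φ n)).PosSemidef :=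
    posSemidef_sum _ fun n _ => by simpa using posSemidef_vecMulVec_self_star (φ n)
  refine ⟨PosDef.one.add_posSemidef hS, ?_⟩
  rw [sum_dotProduct_mulVec_eq_trace]
  simpa using hS.trace_inv_one_add_mul_le
end

section
/- Let H > 0, let φ_1, ..., φ_N ∈ ℝ^d satisfy ‖φ_n‖₂ ≤ 1 for all n, and let v_1, ..., v_N ∈ ℝ satisfy |v_n| ≤ H for all n. Define Λ = I_d + Σ_{n=1}^N φ_n φ_nᵀ and w = Λ⁻¹ Σ_{n=1}^N φ_n v_n. Then ‖w‖₂ ≤ H √(dN). -/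
open Matrix Finset

/-- The regularized Gram matrix `I + ∑ n, φ n (φ n)ᵀ` is positive definite. -/
theorem posDef_one_add_sum_vecMulVec {ι m : Type*} [Fintype ι] [Fintype m] [DecidableEq m]
    (φ : ι → m → ℝ) : (1 + ∑ n, vecMulVec (φ n) (φ n)).PosDef := by
  refine Matrix.PosDef.one.add_posSemidef (Matrix.posSemidef_sum _ fun n _ => ?_)
  simpa using Matrix.posSemidef_vecMulVec_self_star (φ n)

/-- The ridge regression weights `w` satisfy `w ⬝ᵥ w ≤ ∑ n, v n ^ 2 / 4`. -/
theorem ridge_dotProduct_self_le {ι m : Type*} [Fintype ι] [Fintype m] [DecidableEq m]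
    (φ : ι → m → ℝ) (v : ι → ℝ) {w : m → ℝ}
    (hw : w = (1 + ∑ n, vecMulVec (φ n) (φ n))⁻¹ *ᵥ ∑ n, v n • φ n) :
    w ⬝ᵥ w ≤ ∑ n, v n ^ 2 / 4 := by
  have hdet := (Matrix.isUnit_iff_isUnit_det _).mp (posDef_one_add_sum_vecMulVec φ).isUnit
  have normal_eq : (1 + ∑ n, vecMulVec (φ n) (φ n)) *ᵥ w = ∑ n, v n • φ n := by
    rw [hw, mulVec_mulVec, mul_nonsing_inv _ hdet, one_mulVec]
  have energy : w ⬝ᵥ w + ∑ n, (φ n ⬝ᵥ w) * (φ n ⬝ᵥ w) = ∑ n, v n * (φ n ⬝ᵥ w) := by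
    simpa [add_mulVec, sum_mulVec, vecMulVec_mulVec, add_dotProduct, sum_dotProduct]
      using congrArg (· ⬝ᵥ w) normal_eq
  rw [eq_sub_of_add_eq energy, ← sum_sub_distrib]
  exact sum_le_sum fun n _ => by nlinarith [sq_nonneg (v n / 2 - φ n ⬝ᵥ w)]

/-- Lemma D.3 of Qiao–Wang: the least-squares weight vector
`w = Λ⁻¹ ∑_n v_n φ_n` with `Λ = I + ∑_n φ_n φ_nᵀ`, `‖φ_n‖₂ ≤ 1` and `|v_n| ≤ H`,
satisfies `‖w‖₂ ≤ H √(d N)`. -/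
theorem lsvi_weight_bound {d N : ℕ} (hd : 0 < d) (hN : 0 < N)
    (H : ℝ) (hH : 0 < H)
    (φ : Fin N → Fin d → ℝ) (hφ : ∀ n, Real.sqrt (φ n ⬝ᵥ φ n) ≤ 1)
    (v : Fin N → ℝ) (hv : ∀ n, |v n| ≤ H) :
    Real.sqrt
        (((1 + ∑ n, vecMulVec (φ n) (φ n))⁻¹ *ᵥ ∑ n, v n • φ n) ⬝ᵥ
          ((1 + ∑ n, vecMulVec (φ n) (φ n))⁻¹ *ᵥ ∑ n, v n • φ n)) ≤
      H * Real.sqrt (d * N) := by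
  have sum_le : ∑ n, v n ^ 2 / 4 ≤ N * (H ^ 2 / 4) := by
    have := sum_le_card_nsmul univ (fun n => v n ^ 2 / 4) (H ^ 2 / 4) fun n _ => by
      have := sq_le_sq' (neg_le_of_abs_le (hv n)) (le_of_abs_le (hv n))
      linarith
    simpa using this
  have one_le_d : (1 : ℝ) ≤ d := by exact_mod_cast hd
  refine Real.sqrt_le_iff.mpr ⟨by positivity, (ridge_dotProduct_self_le φ v rfl).trans ?_⟩
  rw [mul_pow, Real.sq_sqrt (by positivity)]
  have : (0 : ℝ) ≤ H ^ 2 * N := by positivity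
  nlinarith
end

section
/- Let 0 ≤ A ≤ 1, let φ_1, ..., φ_N ∈ ℝ^d satisfy ‖φ_n‖₂ ≤ 1 for all n, and let v_1, ..., v_N ∈ ℝ satisfy |v_n| ≤ A for all n. Define Λ = I_d + Σ_{n=1}^N φ_n φ_nᵀ and w = Λ⁻¹ Σ_{n=1}^N φ_n v_n. Then ‖w‖₂ ≤ √(dN). -/
open Matrix Finset

/-- The ridge regression weights satisfy `w ⬝ᵥ w + ∑ n, (φ n ⬝ᵥ w) ^ 2 = ∑ n, v n * (φ n ⬝ᵥ w)`;
completing the square bounds their squared norm. -/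
theorem ridge_weight_dotProduct_self_le {ι m : Type*} [Fintype ι] [Fintype m] [DecidableEq m]
    (φ : ι → m → ℝ) (v : ι → ℝ) :
    ((1 + ∑ n, vecMulVec (φ n) (φ n))⁻¹ *ᵥ ∑ n, v n • φ n) ⬝ᵥ
      ((1 + ∑ n, vecMulVec (φ n) (φ n))⁻¹ *ᵥ ∑ n, v n • φ n) ≤ (∑ n, v n ^ 2) / 4 := by
  set w := (1 + ∑ n, vecMulVec (φ n) (φ n))⁻¹ *ᵥ ∑ n, v n • φ n with hw
  have normal_eq : (1 + ∑ n, vecMulVec (φ n) (φ n)) *ᵥ w = ∑ n, v n • φ n := by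
    rw [hw, mulVec_mulVec, mul_nonsing_inv _ ((isUnit_iff_isUnit_det _).mp
      (posDef_one_add_sum_vecMulVec φ).isUnit), one_mulVec]
  have energy_eq : w ⬝ᵥ w + ∑ n, (φ n ⬝ᵥ w) ^ 2 = ∑ n, v n * (φ n ⬝ᵥ w) := by
    have h := congrArg (· ⬝ᵥ w) normal_eq
    simpa [add_mulVec, sum_mulVec, vecMulVec_mulVec, add_dotProduct, sum_dotProduct,
      smul_dotProduct, sq] using h
  have square_le : ∑ n, v n * (φ n ⬝ᵥ w) ≤ ∑ n, (v n ^ 2 / 4 + (φ n ⬝ᵥ w) ^ 2) :=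
    sum_le_sum fun n _ => by nlinarith [sq_nonneg (v n / 2 - φ n ⬝ᵥ w)]
  rw [sum_add_distrib, ← sum_div] at square_le
  linarith

/-- Lemma E.2 of Qiao–Wang: the regression weight vector
`w = Λ⁻¹ ∑_n v_n φ_n` with `Λ = I + ∑_n φ_n φ_nᵀ`, `‖φ_n‖₂ ≤ 1` and `|v_n| ≤ A ≤ 1`,
satisfies `‖w‖₂ ≤ √(d N)`. -/
theorem regression_weight_bound {d N : ℕ} (hd : 0 < d) (hN : 0 < N)
    (A : ℝ) (hA0 : 0 ≤ A) (hA1 : A ≤ 1)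
    (φ : Fin N → Fin d → ℝ) (hφ : ∀ n, Real.sqrt (φ n ⬝ᵥ φ n) ≤ 1)
    (v : Fin N → ℝ) (hv : ∀ n, |v n| ≤ A) :
    Real.sqrt
        (((1 + ∑ n, vecMulVec (φ n) (φ n))⁻¹ *ᵥ ∑ n, v n • φ n) ⬝ᵥ
          ((1 + ∑ n, vecMulVec (φ n) (φ n))⁻¹ *ᵥ ∑ n, v n • φ n)) ≤
      Real.sqrt (d * N) := by
  refine Real.sqrt_le_sqrt ((ridge_weight_dotProduct_self_le φ v).trans ?_)
  have sum_sq_le : ∑ n, v n ^ 2 ≤ (N : ℝ) := by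
    simpa using sum_le_sum fun n (_ : n ∈ univ) =>
      (sq_le_one_iff_abs_le_one (v n)).mpr ((hv n).trans hA1)
  have hd' : (1 : ℝ) ≤ d := by exact_mod_cast hd
  have hN' : (0 : ℝ) ≤ N := N.cast_nonneg
  nlinarith
end
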